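/- Let p ≥ 1, let S be a p×p real symmetric positive semidefinite matrix, let ρ > 0, and set α = 1/(‖S‖₂ + pρ). Let b′ > α, let Θ be a p×p real symmetric positive definite matrix with αI ⪯ Θ ⪯ b′I, and let 0 < ζ ≤ α². Then αI ⪯ η_{ζρ}(Θ − ζ(S − Θ⁻¹)); that is, one G-ISTA step with step size at most α² preserves the lower eigenvalue bound α. -/

import Mathlib

open Matrix

/-- Entrywise soft-thresholding operator `η_c`. -/
noncomputable def softThresh {n : Type*} [Fintype n] (c : ℝ) (X : Matrix n n ℝ) :
    Matrix n n ℝ :=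
  fun i j => Real.sign (X i j) * max (|X i j| - c) 0

/-- Frobenius norm of a real matrix. -/
noncomputable def frobNorm {n : Type*} [Fintype n] (A : Matrix n n ℝ) : ℝ :=
  Real.sqrt (∑ i, ∑ j, (A i j) ^ 2)

/-- Smallest eigenvalue of a real symmetric matrix (as the infimum of the
Rayleigh quotient over the unit sphere). -/
noncomputable def lmin {n : Type*} [Fintype n] (A : Matrix n n ℝ) : ℝ :=
  ⨅ x : {x : n → ℝ // ∑ i, (x i) ^ 2 = 1}, x.1 ⬝ᵥ A.mulVec x.1

/-- Largest eigenvalue of a real symmetric matrix. -/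
noncomputable def lmax {n : Type*} [Fintype n] (A : Matrix n n ℝ) : ℝ :=
  ⨆ x : {x : n → ℝ // ∑ i, (x i) ^ 2 = 1}, x.1 ⬝ᵥ A.mulVec x.1

/-- Spectral norm (largest singular value) of a real matrix. -/
noncomputable def specNorm {n : Type*} [Fintype n] (A : Matrix n n ℝ) : ℝ :=
  ⨆ x : {x : n → ℝ // ∑ i, (x i) ^ 2 = 1}, Real.sqrt (∑ i, (A.mulVec x.1 i) ^ 2)

/-- Soft-thresholding moves every entry by at most the threshold. -/
theorem abs_sub_softThresh_le {n : Type*} [Fintype n] {c : ℝ} (hc : 0 ≤ c)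
    (X : Matrix n n ℝ) (i j : n) : |X i j - softThresh c X i j| ≤ c := by
  unfold softThresh
  rcases lt_trichotomy (X i j) 0 with h | h | h
  · rw [Real.sign_of_neg h, abs_of_neg h, abs_le]
    rcases max_cases (-X i j - c) 0 with ⟨h1, h2⟩ | ⟨h1, h2⟩ <;> rw [h1] <;>
      constructor <;> linarith
  · simpa [h] using hc
  · rw [Real.sign_of_pos h, abs_of_pos h, abs_le]
    rcases max_cases (X i j - c) 0 with ⟨h1, h2⟩ | ⟨h1, h2⟩ <;> rw [h1] <;>
      constructor <;> linarith

theorem Matrix.IsHermitian.softThresh {n : Type*} [Fintype n] {X : Matrix n n ℝ}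
    (hX : X.IsHermitian) (c : ℝ) : (softThresh c X).IsHermitian := by
  ext i j
  have h : X j i = X i j := by simpa using hX.apply i j
  simp [_root_.softThresh, h]

/-- A symmetric matrix with entries bounded by `c` is at most `card n * c` in the Loewner order. -/
theorem posSemidef_smul_one_sub_of_abs_le {n : Type*} [Fintype n] [DecidableEq n]
    {E : Matrix n n ℝ} (hE : E.IsHermitian) {c : ℝ} (hc : ∀ i j, |E i j| ≤ c) :
    ((Fintype.card n * c) • (1 : Matrix n n ℝ) - E).PosSemidef := by
  refine PosSemidef.of_dotProduct_mulVec_nonneg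
    ((isHermitian_one.smul (IsSelfAdjoint.all _)).sub hE) fun x => ?_
  have hterm : ∀ i j, x i * (E i j * x j) ≤ c * ((x i ^ 2 + x j ^ 2) / 2) := fun i j => by
    have hc0 : 0 ≤ c := (abs_nonneg _).trans (hc i j)
    calc x i * (E i j * x j) ≤ |x i * (E i j * x j)| := le_abs_self _
      _ = |E i j| * (|x i| * |x j|) := by rw [abs_mul, abs_mul]; ring
      _ ≤ c * (|x i| * |x j|) := by gcongr; exact hc i j
      _ ≤ c * ((x i ^ 2 + x j ^ 2) / 2) := by
        gcongr
        nlinarith [sq_nonneg (|x i| - |x j|), sq_abs (x i), sq_abs (x j)]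
  have hsum : x ⬝ᵥ E *ᵥ x ≤ Fintype.card n * c * (x ⬝ᵥ x) := by
    calc x ⬝ᵥ E *ᵥ x = ∑ i, ∑ j, x i * (E i j * x j) := by
          simp [dotProduct, mulVec, Finset.mul_sum]
      _ ≤ ∑ i, ∑ j, c * ((x i ^ 2 + x j ^ 2) / 2) :=
          Finset.sum_le_sum fun i _ => Finset.sum_le_sum fun j _ => hterm i j
      _ = Fintype.card n * c * (x ⬝ᵥ x) := by
          simp only [← Finset.mul_sum, ← Finset.sum_div, Finset.sum_add_distrib,
            Finset.sum_const, Finset.card_univ, nsmul_eq_mul, dotProduct, ← pow_two]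
          ring
  simpa [sub_mulVec, smul_mulVec, dotProduct_sub] using hsum

theorem bddAbove_range_sqrt_sum_mulVec_sq {n : Type*} [Fintype n] (A : Matrix n n ℝ) :
    BddAbove (Set.range fun x : {x : n → ℝ // ∑ i, (x i) ^ 2 = 1} =>
      Real.sqrt (∑ i, (A.mulVec x.1 i) ^ 2)) := by
  refine ⟨Real.sqrt (∑ i, ∑ j, A i j ^ 2), ?_⟩
  rintro _ ⟨⟨x, hx⟩, rfl⟩
  refine Real.sqrt_le_sqrt (Finset.sum_le_sum fun i _ => ?_)
  have h := Finset.sum_mul_sq_le_sq_mul_sq Finset.univ (A i) x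
  rwa [hx, mul_one] at h

theorem specNorm_nonneg {n : Type*} [Fintype n] (A : Matrix n n ℝ) : 0 ≤ specNorm A :=
  Real.iSup_nonneg fun _ => Real.sqrt_nonneg _

theorem dotProduct_mulVec_le_specNorm_mul {n : Type*} [Fintype n] (A : Matrix n n ℝ)
    (x : n → ℝ) : x ⬝ᵥ A *ᵥ x ≤ specNorm A * (x ⬝ᵥ x) := by
  have hunit : ∀ u : n → ℝ, ∑ i, u i ^ 2 = 1 → u ⬝ᵥ A *ᵥ u ≤ specNorm A := fun u hu => by
    refine le_trans ?_ (le_ciSup (bddAbove_range_sqrt_sum_mulVec_sq A) ⟨u, hu⟩)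
    refine Real.le_sqrt_of_sq_le ?_
    have h := Finset.sum_mul_sq_le_sq_mul_sq Finset.univ u (A *ᵥ u)
    rwa [hu, one_mul] at h
  by_cases hx : x = 0
  · simp [hx]
  have hpos : 0 < x ⬝ᵥ x := by
    simpa using dotProduct_star_self_pos_iff.mpr hx
  have hsq : Real.sqrt (x ⬝ᵥ x) ^ 2 = x ⬝ᵥ x := Real.sq_sqrt hpos.le
  have h := hunit ((Real.sqrt (x ⬝ᵥ x))⁻¹ • x) (by
    simp only [Pi.smul_apply, smul_eq_mul, mul_pow, ← Finset.mul_sum, inv_pow, hsq]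
    rw [show ∑ i, x i ^ 2 = x ⬝ᵥ x by simp [dotProduct, pow_two]]
    exact inv_mul_cancel₀ hpos.ne')
  rw [mulVec_smul, dotProduct_smul, smul_dotProduct, smul_eq_mul, smul_eq_mul, ← mul_assoc,
    ← pow_two, inv_pow, hsq, inv_mul_le_iff₀ hpos] at h
  linarith

theorem posSemidef_specNorm_smul_one_sub {n : Type*} [Fintype n] [DecidableEq n]
    {A : Matrix n n ℝ} (hA : A.IsHermitian) :
    (specNorm A • (1 : Matrix n n ℝ) - A).PosSemidef := by
  refine PosSemidef.of_dotProduct_mulVec_nonneg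
    ((isHermitian_one.smul (IsSelfAdjoint.all _)).sub hA) fun x => ?_
  simpa [sub_mulVec, smul_mulVec, dotProduct_sub] using dotProduct_mulVec_le_specNorm_mul A x

/-- If `α I ⪯ Θ` with `α > 0`, then `α Θ⁻¹ ⪯ I`. -/
theorem posSemidef_one_sub_smul_inv {n : Type*} [Fintype n] [DecidableEq n]
    {Θ : Matrix n n ℝ} (hΘ : Θ.PosDef) {α : ℝ} (hα : 0 ≤ α)
    (hlow : (Θ - α • (1 : Matrix n n ℝ)).PosSemidef) :
    ((1 : Matrix n n ℝ) - α • Θ⁻¹).PosSemidef := by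
  have hdet : IsUnit Θ.det := (isUnit_iff_isUnit_det _).mp hΘ.isUnit
  have h1 : Θ⁻¹ * Θ = 1 := nonsing_inv_mul _ hdet
  have h2 : Θ * Θ⁻¹ = 1 := mul_nonsing_inv _ hdet
  have hi : (Θ⁻¹)ᴴ = Θ⁻¹ := hΘ.inv.isHermitian
  have hD : (Θ - α • (1 : Matrix n n ℝ))ᴴ = Θ - α • 1 := hlow.isHermitian
  have hsq := (posSemidef_conjTranspose_mul_self
    (Θ - α • (1 : Matrix n n ℝ))).add (hlow.smul hα)
  have h := hsq.conjTranspose_mul_mul_same Θ⁻¹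
  rw [hi, hD] at h
  convert h using 1
  have hfac : (Θ - α • (1 : Matrix n n ℝ)) * (Θ - α • 1) + α • (Θ - α • 1)
      = Θ * (Θ - α • 1) := by
    simp only [sub_mul, smul_mul_assoc, one_mul]
    abel
  rw [hfac, ← mul_assoc, h1, one_mul, sub_mul, h2, smul_mul_assoc, one_mul]

/-- Matrix version of the monotonicity of `t ↦ t + ζ / t` on `[√ζ, ∞)`. -/
theorem posSemidef_add_smul_inv_sub {n : Type*} [Fintype n] [DecidableEq n]
    {Θ : Matrix n n ℝ} (hΘ : Θ.PosDef) {α ζ : ℝ} (hα : 0 < α)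
    (hlow : (Θ - α • (1 : Matrix n n ℝ)).PosSemidef) (hζ : ζ ≤ α ^ 2) :
    (Θ + ζ • Θ⁻¹ - (α + ζ / α) • (1 : Matrix n n ℝ)).PosSemidef := by
  have hdet : IsUnit Θ.det := (isUnit_iff_isUnit_det _).mp hΘ.isUnit
  have h2 : Θ * Θ⁻¹ = 1 := mul_nonsing_inv _ hdet
  have h1 : Θ⁻¹ * Θ = 1 := nonsing_inv_mul _ hdet
  have hD : (Θ - α • (1 : Matrix n n ℝ))ᴴ = Θ - α • 1 := hlow.isHermitian
  have hδ : 0 ≤ α - ζ / α := by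
    rw [sub_nonneg, div_le_iff₀ hα]
    linarith
  have hexp : (Θ - α • (1 : Matrix n n ℝ)) * Θ⁻¹ * (Θ - α • 1)
      = Θ - (2 * α) • 1 + (α ^ 2) • Θ⁻¹ := by
    rw [sub_mul, h2, smul_mul_assoc, one_mul, mul_sub, sub_mul, one_mul, smul_mul_assoc, h1,
      mul_smul_comm, mul_one]
    module
  have hc : (α - ζ / α) * α = α ^ 2 - ζ := by field_simp
  have heq : Θ + ζ • Θ⁻¹ - (α + ζ / α) • (1 : Matrix n n ℝ)
      = (Θ - α • 1) * Θ⁻¹ * (Θ - α • 1) + (α - ζ / α) • (1 - α • Θ⁻¹) := by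
    rw [hexp, smul_sub, smul_smul, hc]
    module
  have hsq := hΘ.inv.posSemidef.conjTranspose_mul_mul_same (Θ - α • (1 : Matrix n n ℝ))
  rw [hD] at hsq
  rw [heq]
  exact hsq.add ((posSemidef_one_sub_smul_inv hΘ hα.le hlow).smul hδ)

/-- One G-ISTA step with step size `ζ ≤ α²` preserves the lower eigenvalue
bound `α = 1/(‖S‖₂ + pρ)`. -/
theorem gista_step_preserves_lower_bound {p : ℕ} (hp : 0 < p)
    (S : Matrix (Fin p) (Fin p) ℝ) (hS : S.PosSemidef)
    (ρ : ℝ) (hρ : 0 < ρ)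
    (α : ℝ) (hα : α = 1 / (specNorm S + p * ρ))
    (b' : ℝ) (hb' : α < b')
    (Θ : Matrix (Fin p) (Fin p) ℝ) (hΘ : Θ.PosDef)
    (hlow : (Θ - α • 1).PosSemidef) (hup : (b' • 1 - Θ).PosSemidef)
    (ζ : ℝ) (hζ0 : 0 < ζ) (hζ : ζ ≤ α ^ 2) :
    (softThresh (ζ * ρ) (Θ - ζ • (S - Θ⁻¹)) - α • 1).PosSemidef := by
  have hs := specNorm_nonneg S
  have hp' : (0 : ℝ) < p := Nat.cast_pos.mpr hp
  have hden : 0 < specNorm S + p * ρ := by positivity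
  have hα0 : 0 < α := hα ▸ one_div_pos.mpr hden
  have hζα : ζ / α = ζ * specNorm S + p * (ζ * ρ) := by
    rw [hα, div_div_eq_mul_div]
    ring
  set X := Θ - ζ • (S - Θ⁻¹) with hXdef
  have hX : X.IsHermitian := hΘ.isHermitian.sub
    ((hS.isHermitian.sub hΘ.inv.isHermitian).smul (IsSelfAdjoint.all _))
  have hE := posSemidef_smul_one_sub_of_abs_le (hX.sub (hX.softThresh (ζ * ρ)))
    (abs_sub_softThresh_le (mul_pos hζ0 hρ).le X)
  rw [Fintype.card_fin] at hE
  have h := (hE.add (posSemidef_add_smul_inv_sub hΘ hα0 hlow hζ)).add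
    ((posSemidef_specNorm_smul_one_sub hS.isHermitian).smul hζ0.le)
  convert h using 1
  rw [hζα, hXdef]
  module
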